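/- For trees T, T' in the space 𝕋 of locally finite rooted trees, write T ↪ T' if there exists a root-preserving injective graph homomorphism from T to T'. Then T and T' are isomorphic (as rooted trees) if and only if T ↪ T' and T' ↪ T. -/

import Mathlib

/-- Endpoints of walks of length `n` from `ρ`. -/
def stepSet {V : Type*} (G : SimpleGraph V) (ρ : V) : ℕ → Set V
  | 0 => {ρ}
  | n + 1 => ⋃ u ∈ stepSet G ρ n, G.neighborSet u

theorem stepSet_finite {V : Type*} (G : SimpleGraph V) (ρ : V)
    (hlf : ∀ v, (G.neighborSet v).Finite) (n : ℕ) : (stepSet G ρ n).Finite := by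
  induction n with
  | zero => exact Set.finite_singleton _
  | succ n ih => exact ih.biUnion fun u _ => hlf u

theorem stepSet_map {V : Type*} (G : SimpleGraph V) (ρ : V)
    (h : G →g G) (hρ : h ρ = ρ) (n : ℕ) : Set.MapsTo h (stepSet G ρ n) (stepSet G ρ n) := by
  induction n with
  | zero =>
    intro x hx
    have hx' : x = ρ := hx
    subst hx'
    exact hρ
  | succ n ih =>
    intro x hx
    simp only [stepSet, Set.mem_iUnion, SimpleGraph.mem_neighborSet] at hx ⊢
    obtain ⟨u, hu, hux⟩ := hx
    exact ⟨h u, ih hu, h.map_adj hux⟩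

theorem stepSet_walk {V : Type*} (G : SimpleGraph V) (ρ : V) {u v : V} (w : G.Walk u v) :
    ∀ n, u ∈ stepSet G ρ n → ∃ m, v ∈ stepSet G ρ m := by
  induction w with
  | nil => exact fun n hn => ⟨n, hn⟩
  | cons h p ih =>
    intro n hn
    refine ih (n + 1) ?_
    simp only [stepSet, Set.mem_iUnion, SimpleGraph.mem_neighborSet]
    exact ⟨_, hn, h⟩

theorem self_hom_surjective {V : Type*} (G : SimpleGraph V) (ρ : V) (hG : G.Connected)
    (hlf : ∀ v, (G.neighborSet v).Finite) (h : G →g G) (hi : Function.Injective h)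
    (hρ : h ρ = ρ) : Function.Surjective h := by
  intro v
  obtain ⟨w⟩ := hG.preconnected ρ v
  obtain ⟨m, hm⟩ := stepSet_walk G ρ w 0 rfl
  have this : Set.image h (stepSet G ρ m) = stepSet G ρ m :=
    Set.eq_of_subset_of_ncard_le (stepSet_map G ρ h hρ m).image_subset
      (Set.ncard_image_of_injective _ hi).ge (stepSet_finite G ρ hlf m)
  rw [← this] at hm
  obtain ⟨x, -, hx⟩ := hm
  exact ⟨x, hx⟩

/-- for rooted locally finite trees, mutual root-preserving injective graph
homomorphisms (embeddings) in both directions imply the existence of a root-preserving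
isomorphism. -/
theorem stmt_8 {V V' : Type*} (G : SimpleGraph V) (G' : SimpleGraph V') (ρ : V) (ρ' : V')
    (hG : G.IsTree) (hG' : G'.IsTree)
    (hlf : ∀ v, (G.neighborSet v).Finite) (hlf' : ∀ v, (G'.neighborSet v).Finite)
    (f : G →g G') (hf : Function.Injective f) (hfρ : f ρ = ρ')
    (g : G' →g G) (hg : Function.Injective g) (hgρ : g ρ' = ρ) :
    ∃ e : G ≃g G', e ρ = ρ' := by
  have hs : Function.Surjective f := by
    have := self_hom_surjective G' ρ' hG'.connected hlf' (f.comp g)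
      (by simpa using hf.comp hg) (by simp [hgρ, hfρ])
    intro y
    obtain ⟨x, hx⟩ := this y
    exact ⟨g x, hx⟩
  refine ⟨⟨Equiv.ofBijective f ⟨hf, hs⟩, ?_⟩, hfρ⟩
  intro a b
  refine ⟨fun hab => ?_, fun hab => f.map_adj hab⟩
  have hab' : G'.Adj (f a) (f b) := hab
  obtain ⟨p, hp⟩ := hG.connected.exists_isPath a b
  have h1 : (p.map f).IsPath := SimpleGraph.Walk.map_isPath_of_injective hf hp
  have h2 : (hab'.toWalk).IsPath := by
    simp [SimpleGraph.Adj.toWalk, hab'.ne]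
  have h3 := hG'.isAcyclic.path_unique ⟨_, h1⟩ ⟨_, h2⟩
  have h4 : (p.map f) = hab'.toWalk := congrArg Subtype.val h3
  have h5 := congrArg SimpleGraph.Walk.length h4
  simp only [SimpleGraph.Walk.length_map] at h5
  exact SimpleGraph.Walk.adj_of_length_eq_one (h5.trans rfl)
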